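/- For every integer n >= 1, the inequality p(n+1) <= p(n) holds, where p(n) is the probability that the root of a uniformly random decreasing binary tree on [n] is balanced. -/

import Mathlib

namespace BalancedTrees

/-- Plane binary trees with vertices labeled by natural numbers;
`nil` is the empty tree, and each child of a vertex is designated
as a left child or a right child. -/
inductive BT where
  | nil : BT
  | node (label : ℕ) (l r : BT) : BT
deriving DecidableEq

namespace BT

/-- `balRank t = some k` if and only if the root of `t` is a balanced vertex of
rank `k`, i.e. every descending path from the root to a leaf has length `k`. -/
def balRank : BT → Option ℕ
  | .nil => none
  | .node _ .nil .nil => some 0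
  | .node _ .nil (.node b rl rr) => (balRank (BT.node b rl rr)).map (· + 1)
  | .node _ (.node a ll lr) .nil => (balRank (BT.node a ll lr)).map (· + 1)
  | .node _ (.node a ll lr) (.node b rl rr) =>
      match balRank (BT.node a ll lr), balRank (BT.node b rl rr) with
      | some i, some j => if i = j then some (i + 1) else none
      | _, _ => none

/-- The number of balanced vertices of rank `k` in the tree `t`. -/
def countBal (k : ℕ) : BT → ℕ
  | .nil => 0
  | .node v l r =>
      countBal k l + countBal k r +
        (if balRank (BT.node v l r) = some k then 1 else 0)

/-- The number of balanced vertices (of any rank) in the tree `t`. -/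
def countBalAll : BT → ℕ
  | .nil => 0
  | .node v l r =>
      countBalAll l + countBalAll r +
        (if (balRank (BT.node v l r)).isSome then 1 else 0)

/-- Auxiliary, fuelled version of `treeOf`. -/
def treeOfAux : ℕ → List ℕ → BT
  | 0, _ => .nil
  | _ + 1, [] => .nil
  | fuel + 1, l =>
      let m := l.foldr max 0
      BT.node m (treeOfAux fuel (l.takeWhile (· != m)))
                (treeOfAux fuel ((l.dropWhile (· != m)).tail))

/-- The decreasing binary tree `T(π)` of a sequence `π` of distinct labels:
the root is the maximum entry, and its left (resp. right) subtree is built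
recursively from the part of the sequence to the left (resp. right) of the
maximum. This is a bijection between permutations of `{1,…,n}` and
decreasing binary trees on `{1,…,n}`. -/
def treeOf (l : List ℕ) : BT := treeOfAux l.length l

/-- Canonical form for non-plane 1-2 trees (as represented by plane trees):
an only child is stored as a left child, and of two (unordered) children the
one with the larger label is stored on the left. Decreasing binary trees in
canonical form are in bijection with non-plane 1-2 trees. -/
def canonNP : BT → Bool
  | .nil => true
  | .node _ l r =>
      canonNP l && canonNP r &&
        (match l, r with
         | .nil, .nil => true
         | .node _ _ _, .nil => true
         | .nil, .node _ _ _ => false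
         | .node a _ _, .node b _ _ => decide (b < a))

/-- Canonical form for plane 1-2 trees: an only child is stored as a left
child (an only child carries no left/right designation), while two children
remain ordered. Decreasing binary trees in canonical form are in bijection
with plane 1-2 trees. -/
def canonP : BT → Bool
  | .nil => true
  | .node _ l r =>
      canonP l && canonP r &&
        (match l, r with
         | .nil, .node _ _ _ => false
         | _, _ => true)

end BT

open BT

/-- The list of all permutations of `{1,…,n}`, each written as a list. -/
def perms (n : ℕ) : List (List ℕ) := (List.range' 1 n).permutations

/-- `a n k`: the total number of balanced vertices of rank `k` over all
decreasing binary trees on `{1,…,n}`. -/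
def a (n k : ℕ) : ℕ := ((perms n).map fun l => countBal k (treeOf l)).sum

/-- `r n k`: the number of decreasing binary trees on `{1,…,n}` whose root is
balanced of rank `k`. -/
def r (n k : ℕ) : ℕ :=
  ((perms n).filter fun l => decide (balRank (treeOf l) = some k)).length

/-- `p n k`: the probability that the root of a uniformly random decreasing
binary tree on `{1,…,n}` is balanced of rank `k`; by convention `p 0 k = 1`. -/
def p (n k : ℕ) : ℚ := if n = 0 then 1 else (r n k : ℚ) / (Nat.factorial n : ℚ)

/-- The number of decreasing binary trees on `{1,…,n}` whose root is balanced. -/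
def rootBal (n : ℕ) : ℕ :=
  ((perms n).filter fun l => (balRank (treeOf l)).isSome).length

/-- `proot n`: the probability that the root of a uniformly random decreasing
binary tree on `{1,…,n}` is balanced. -/
def proot (n : ℕ) : ℚ := (rootBal n : ℚ) / (Nat.factorial n : ℚ)

/-- The total number of balanced vertices over all decreasing binary trees
on `{1,…,n}`. -/
def totalBal (n : ℕ) : ℕ := ((perms n).map fun l => countBalAll (treeOf l)).sum

/-- `Pbal n`: the probability that a vertex chosen uniformly at random from
the `n * n!` vertices of all decreasing binary trees on `{1,…,n}` is balanced. -/
def Pbal (n : ℕ) : ℚ := (totalBal n : ℚ) / ((n : ℚ) * (Nat.factorial n : ℚ))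

/-- Permutations whose decreasing binary tree is a canonical representative
of a non-plane 1-2 tree; these are in bijection with non-plane 1-2 trees
on `{1,…,n}`. -/
def npPerms (n : ℕ) : List (List ℕ) := (perms n).filter fun l => canonNP (treeOf l)

/-- `E n`: the number of non-plane 1-2 trees on `{1,…,n}` (the Euler number). -/
def E (n : ℕ) : ℕ := (npPerms n).length

/-- `b n k`: the total number of balanced vertices of rank `k` over all
non-plane 1-2 trees on `{1,…,n}`. -/
def b (n k : ℕ) : ℕ := ((npPerms n).map fun l => countBal k (treeOf l)).sum

/-- `s n k`: the number of non-plane 1-2 trees on `{1,…,n}` whose root is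
balanced of rank `k`. -/
def s (n k : ℕ) : ℕ :=
  ((npPerms n).filter fun l => decide (balRank (treeOf l) = some k)).length

/-- Permutations whose decreasing binary tree is a canonical representative
of a plane 1-2 tree; these are in bijection with plane 1-2 trees on `{1,…,n}`. -/
def pPerms (n : ℕ) : List (List ℕ) := (perms n).filter fun l => canonP (treeOf l)

/-- `z n`: the number of plane 1-2 trees on `{1,…,n}`. -/
def z (n : ℕ) : ℕ := (pPerms n).length

/-- `d n k`: the total number of balanced vertices of rank `k` over all
plane 1-2 trees on `{1,…,n}`. -/
def d (n k : ℕ) : ℕ := ((pPerms n).map fun l => countBal k (treeOf l)).sum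

/-- `t n k`: the number of plane 1-2 trees on `{1,…,n}` whose root is
balanced of rank `k`. -/
def t (n k : ℕ) : ℕ :=
  ((pPerms n).filter fun l => decide (balRank (treeOf l) = some k)).length

end BalancedTrees

namespace BalancedTrees

/-- The number of decreasing binary trees with `n` vertices whose root is balanced of rank `k`,
computed by the recursion that splits off the root. -/
def rankCount : ℕ → ℕ → ℕ
  | 0, n => if n = 1 then 1 else 0
  | _ + 1, 0 => 0
  | k + 1, n + 1 => 2 * rankCount k n +
      ∑ i ∈ Finset.range (n + 1), n.choose i * rankCount k i * rankCount k (n - i)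

theorem rankCount_zero_right (k : ℕ) : rankCount k 0 = 0 := by
  cases k <;> simp [rankCount]

theorem rankCount_succ_succ (k n : ℕ) : rankCount (k + 1) (n + 1) = 2 * rankCount k n +
    ∑ i ∈ Finset.range (n + 1), n.choose i * rankCount k i * rankCount k (n - i) := by
  rw [rankCount]

theorem rankCount_eq_zero_of_le {k n : ℕ} (h : n ≤ k) : rankCount k n = 0 := by
  induction k generalizing n with
  | zero => simp [rankCount, Nat.le_zero.mp h]
  | succ k ih =>
    cases n with
    | zero => exact rankCount_zero_right _
    | succ n =>
      rw [rankCount_succ_succ, ih (by omega), mul_zero, zero_add]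
      refine Finset.sum_eq_zero fun i hi => ?_
      rw [Finset.mem_range] at hi
      rw [ih (n := i) (by omega)]
      simp

theorem rankCount_eq_zero_of_two_pow_le {k n : ℕ} (h : 2 ^ (k + 1) ≤ n) :
    rankCount k n = 0 := by
  induction k generalizing n with
  | zero => simp [rankCount]; omega
  | succ k ih =>
    cases n with
    | zero => exact rankCount_zero_right _
    | succ n =>
      have h1 : 1 ≤ 2 ^ (k + 1) := Nat.one_le_two_pow
      rw [pow_succ] at h
      rw [rankCount_succ_succ, ih (by omega), mul_zero, zero_add]
      refine Finset.sum_eq_zero fun i hi => ?_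
      rw [Finset.mem_range] at hi
      by_cases hi' : 2 ^ (k + 1) ≤ i
      · simp [ih hi']
      · simp [ih (n := n - i) (by omega)]

/-! ### Probabilities -/

/-- The probability that a random decreasing binary tree with `n` vertices has a balanced root
of rank `k`. -/
def rankProb (k n : ℕ) : ℚ := rankCount k n / n.factorial

theorem rankProb_nonneg (k n : ℕ) : 0 ≤ rankProb k n := by
  unfold rankProb; positivity

theorem rankProb_eq_zero_of_le {k n : ℕ} (h : n ≤ k) : rankProb k n = 0 := by
  simp [rankProb, rankCount_eq_zero_of_le h]

theorem rankProb_succ_succ (k n : ℕ) : (n + 1) * rankProb (k + 1) (n + 1) =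
    2 * rankProb k n + ∑ i ∈ Finset.range (n + 1), rankProb k i * rankProb k (n - i) := by
  have hn : (n.factorial : ℚ) ≠ 0 := by positivity
  have h : ∀ i ∈ Finset.range (n + 1), rankProb k i * rankProb k (n - i) =
      (n.choose i * rankCount k i * rankCount k (n - i) : ℚ) / n.factorial := by
    intro i hi
    rw [Finset.mem_range] at hi
    rw [Nat.cast_choose ℚ (by omega : i ≤ n), rankProb, rankProb]
    field_simp
  rw [Finset.sum_congr rfl h, ← Finset.sum_div, rankProb, rankProb, rankCount_succ_succ,
    Nat.factorial_succ]
  push_cast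
  field_simp

theorem sum_rankProb_eq_zero {k n : ℕ} (h : n < 2 * k + 2) :
    ∑ i ∈ Finset.range (n + 1), rankProb k i * rankProb k (n - i) = 0 := by
  refine Finset.sum_eq_zero fun i _ => ?_
  by_cases hi : i ≤ k
  · simp [rankProb_eq_zero_of_le hi]
  · simp [rankProb_eq_zero_of_le (k := k) (n := n - i) (by omega)]

/-- The smallest trees of rank `k + 1` are obtained by adding a root to those of rank `k`. -/
theorem rankProb_succ_edge (k : ℕ) :
    (k + 2) * rankProb (k + 1) (k + 2) = 2 * rankProb k (k + 1) := by
  have h := rankProb_succ_succ k (k + 1)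
  push_cast at h
  by_cases hk : k = 0
  · subst hk
    simp [Finset.sum_range_succ, rankProb, rankCount] at h ⊢
    try linarith
  · rw [sum_rankProb_eq_zero (by omega)] at h
    linarith

theorem rankProb_second_edge {k : ℕ} (hk : 1 ≤ k) :
    (k + 2) * rankProb k (k + 2) = rankProb k (k + 1) := by
  induction k, hk using Nat.le_induction with
  | base => 
    norm_num [Finset.sum_range_succ, rankProb, rankCount, Nat.factorial]
  | succ k hk ih =>
    have h := rankProb_succ_succ k (k + 2)
    rw [sum_rankProb_eq_zero (by omega)] at h
    have h' := rankProb_succ_edge k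
    push_cast at h ⊢
    have : (0 : ℚ) < k + 2 := by positivity
    have e : (k + 2 : ℚ) * ((k + 1 + 2) * rankProb (k + 1) (k + 1 + 2)) =
        (k + 2) * rankProb (k + 1) (k + 1 + 1) := by
      rw [show k + 1 + 2 = k + 2 + 1 from rfl, show k + 1 + 1 = k + 2 from rfl, h']
      linear_combination (k + 2) * h + 2 * ih
    exact mul_left_cancel₀ this.ne' e

/-! ### The convolution inequality -/

/-- If `x` vanishes below `e`, is antitone from `e` on and drops by a factor `e + 1` just after
`e`, then the average of its self-convolution over the antidiagonals decreases. -/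
theorem convolution_le {x : ℕ → ℚ} {e : ℕ} (he0 : 1 ≤ e) (h0 : ∀ i, 0 ≤ x i) (hz : ∀ i < e, x i = 0)
    (hx : ∀ i, e ≤ i → x (i + 1) ≤ x i) (he : (e + 1) * x (e + 1) ≤ x e) {n : ℕ}
    (hn : 2 * e ≤ n) :
    (n + 1) * ∑ i ∈ Finset.range (n + 2), x i * x (n + 1 - i) ≤
      (n + 2) * ∑ i ∈ Finset.range (n + 1), x i * x (n - i) := by
  have symm : ∀ (m : ℕ) (c : ℚ), (m + 2 * c) * ∑ i ∈ Finset.range (m + 1), x i * x (m - i) =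
      2 * ∑ i ∈ Finset.range (m + 1), (i + c) * (x i * x (m - i)) := by
    intro m c
    have h1 := Finset.sum_range_reflect (fun i => ((i : ℚ) + c) * (x i * x (m - i))) (m + 1)
    have h2 : ∑ i ∈ Finset.range (m + 1), (((m + 1 - 1 - i : ℕ) : ℚ) + c) *
        (x (m + 1 - 1 - i) * x (m - (m + 1 - 1 - i))) =
        ∑ i ∈ Finset.range (m + 1), ((m : ℚ) - i + c) * (x i * x (m - i)) := by
      refine Finset.sum_congr rfl fun i hi => ?_
      rw [Finset.mem_range] at hi
      rw [show m + 1 - 1 - i = m - i by omega, show m - (m - i) = i by omega,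
        Nat.cast_sub (by omega)]
      ring
    rw [h2] at h1
    rw [two_mul (∑ i ∈ Finset.range (m + 1), ((i : ℚ) + c) * (x i * x (m - i)))]
    nth_rw 1 [← h1]
    rw [← Finset.sum_add_distrib, Finset.mul_sum]
    exact Finset.sum_congr rfl fun i _ => by ring
  have key : 0 ≤ ∑ i ∈ Finset.range (n + 1),
      ((i + 1 : ℚ) * (x i * x (n - i)) - (i + 1 : ℚ) * (x (i + 1) * x (n - i)) -
        ((if i = e then e * (x e * x (n - e)) else 0) -
          if i = e - 1 then e * (x e * x (n - e)) else 0)) := by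
    refine Finset.sum_nonneg fun i _ => ?_
    rcases lt_trichotomy i e with h | rfl | h
    · rw [if_neg h.ne, hz i h]
      by_cases h' : i = e - 1
      · obtain rfl : e = i + 1 := by omega
        rw [if_pos h']
        have h1 := hx (n - (i + 1)) (by omega)
        rw [show n - (i + 1) + 1 = n - i by omega] at h1
        have h2 := mul_le_mul_of_nonneg_left h1 (mul_nonneg (by positivity) (h0 (i + 1)) :
          (0 : ℚ) ≤ (i + 1) * x (i + 1))
        push_cast
        linarith
      · rw [if_neg h', hz (i + 1) (by omega)]
        simp
    · rw [if_pos rfl, if_neg (by omega)]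
      nlinarith [h0 (n - i)]
    · rw [if_neg h.ne', if_neg (by omega), sub_zero, sub_zero, ← mul_sub, ← sub_mul]
      exact mul_nonneg (by positivity) (mul_nonneg (by linarith [hx i h.le]) (h0 (n - i)))
  rw [Finset.sum_sub_distrib, Finset.sum_sub_distrib, Finset.sum_sub_distrib,
    Finset.sum_ite_eq', Finset.sum_ite_eq', if_pos (by rw [Finset.mem_range]; omega),
    if_pos (by rw [Finset.mem_range]; omega)] at key
  have h1 := symm (n + 1) 0
  have h2 := symm n 1
  rw [Finset.sum_range_succ' (fun i : ℕ => ((i : ℚ) + 0) * (x i * x (n + 1 - i)))] at h1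
  have h3 : ∑ i ∈ Finset.range (n + 1), (((i + 1 : ℕ) : ℚ) + 0) *
      (x (i + 1) * x (n + 1 - (i + 1))) =
      ∑ i ∈ Finset.range (n + 1), (i + 1 : ℚ) * (x (i + 1) * x (n - i)) :=
    Finset.sum_congr rfl fun i _ => by
      rw [Nat.add_sub_add_right]
      push_cast
      ring
  rw [h3] at h1
  push_cast at h1
  rw [show n + 1 + 1 = n + 2 from rfl] at h1
  linarith

/-- The probability of a balanced root of rank `k` decreases with the number of vertices, as soon
as trees of rank `k` exist. -/
def RankAntitone (k : ℕ) : Prop := ∀ n, k + 1 ≤ n → rankProb k (n + 1) ≤ rankProb k n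

theorem RankAntitone.succ {k : ℕ} (hk : 1 ≤ k) (h : RankAntitone k)
    (hmid : rankProb (k + 1) (2 * k + 3) ≤ rankProb (k + 1) (2 * k + 2)) :
    RankAntitone (k + 1) := by
  intro n hn
  obtain ⟨n, rfl⟩ : ∃ m, n = m + 1 := ⟨n - 1, by omega⟩
  rcases eq_or_ne n (2 * k + 1) with rfl | hne
  · exact hmid
  have h1 := rankProb_succ_succ k (n + 1)
  have h2 := rankProb_succ_succ k n
  have h3 := h n (by omega)
  have h4 := rankProb_nonneg k (n + 1)
  have h5 : (n + 1) * ∑ i ∈ Finset.range (n + 2), rankProb k i * rankProb k (n + 1 - i) ≤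
      (n + 2) * ∑ i ∈ Finset.range (n + 1), rankProb k i * rankProb k (n - i) := by
    rcases lt_or_ge n (2 * k + 2) with hlt | hge
    · rw [sum_rankProb_eq_zero (n := n + 1) (by omega), sum_rankProb_eq_zero (n := n) hlt]
      simp
    · refine convolution_le (e := k + 1) (by omega) (rankProb_nonneg k)
        (fun i hi => rankProb_eq_zero_of_le (by omega)) h ?_ (by omega)
      have := rankProb_second_edge hk
      push_cast
      rw [show k + 1 + 1 = k + 2 from rfl]
      linarith
  push_cast at h1
  rw [show n + 1 + 1 = n + 2 from rfl] at h1
  have h6 : (0 : ℚ) < (n + 1) * (n + 2) := by positivity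
  refine le_of_mul_le_mul_left ?_ h6
  have h7 : (n + 1 : ℚ) * rankProb k (n + 1) ≤ (n + 2) * rankProb k n := by
    have := rankProb_nonneg k n
    nlinarith
  calc (n + 1 : ℚ) * (n + 2) * rankProb (k + 1) (n + 2)
      = 2 * ((n + 1) * rankProb k (n + 1)) + (n + 1) *
        ∑ i ∈ Finset.range (n + 2), rankProb k i * rankProb k (n + 1 - i) := by
        linear_combination (n + 1 : ℚ) * h1
    _ ≤ 2 * ((n + 2) * rankProb k n) + (n + 2) *
        ∑ i ∈ Finset.range (n + 1), rankProb k i * rankProb k (n - i) := by linarith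
    _ = (n + 1 : ℚ) * (n + 2) * rankProb (k + 1) (n + 1) := by
        linear_combination -(n + 2 : ℚ) * h2

theorem rankProb_mid {k : ℕ} (h : RankAntitone k)
    (hk : (k + 1) * rankProb k (k + 1) ^ 2 ≤ rankProb k (2 * k + 1)) :
    rankProb (k + 1) (2 * k + 3) ≤ rankProb (k + 1) (2 * k + 2) := by
  have h1 := rankProb_succ_succ k (2 * k + 2)
  have h2 := rankProb_succ_succ k (2 * k + 1)
  rw [sum_rankProb_eq_zero (by omega)] at h2
  rw [Finset.sum_eq_single (k + 1)] at h1
  rotate_left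
  · intro i hi hne
    rw [Finset.mem_range] at hi
    rcases lt_or_gt_of_ne hne with h' | h'
    · rw [rankProb_eq_zero_of_le (n := i) (by omega), zero_mul]
    · rw [rankProb_eq_zero_of_le (n := 2 * k + 2 - i) (by omega), mul_zero]
  · intro hi
    exact absurd (Finset.mem_range.mpr (by omega)) hi
  rw [show 2 * k + 2 - (k + 1) = k + 1 by omega] at h1
  have h3 := h (2 * k + 1) (by omega)
  push_cast at h1 h2
  rw [show 2 * k + 2 + 1 = 2 * k + 3 from rfl] at h1
  rw [show 2 * k + 1 + 1 = 2 * k + 2 from rfl] at h2 h3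
  have h4 : (0 : ℚ) < (2 * k + 2) * (2 * k + 3) := by positivity
  refine le_of_mul_le_mul_left ?_ h4
  have h5 : (0 : ℚ) ≤ 2 * k + 2 := by positivity
  calc (2 * k + 2 : ℚ) * (2 * k + 3) * rankProb (k + 1) (2 * k + 3)
      = (2 * k + 2) * (2 * rankProb k (2 * k + 2)) +
        2 * ((k + 1) * rankProb k (k + 1) ^ 2) := by
        linear_combination (2 * k + 2 : ℚ) * h1
    _ ≤ (2 * k + 2) * (2 * rankProb k (2 * k + 1)) + 2 * rankProb k (2 * k + 1) := by
        gcongr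
    _ = (2 * k + 2 : ℚ) * (2 * k + 3) * rankProb (k + 1) (2 * k + 2) := by
        linear_combination -(2 * k + 3 : ℚ) * h2

/-! ### Growth of the number of trees with `2 * k + 1` vertices and rank `k` -/

theorem two_mul_rankCount_le (k n : ℕ) : 2 * rankCount k n ≤ rankCount (k + 1) (n + 1) := by
  rw [rankCount_succ_succ]; omega

theorem two_pow_mul_rankCount_le (k n m : ℕ) :
    2 ^ m * rankCount k n ≤ rankCount (k + m) (n + m) := by
  induction m with
  | zero => simp
  | succ m ih =>
    have := two_mul_rankCount_le (k + m) (n + m)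
    rw [pow_succ]
    rw [← add_assoc, ← add_assoc]
    linarith

theorem two_mul_choose_mul_rankCount_le (k : ℕ) {i j : ℕ} (h : i ≠ j) :
    2 * (i + j).choose i * rankCount k i * rankCount k j ≤ rankCount (k + 1) (i + j + 1) := by
  rw [rankCount_succ_succ]
  have h1 : ({i, j} : Finset ℕ) ⊆ Finset.range (i + j + 1) := by
    intro x hx
    simp only [Finset.mem_insert, Finset.mem_singleton] at hx
    rw [Finset.mem_range]
    omega
  have h2 := Finset.sum_le_sum_of_subset
    (f := fun l => (i + j).choose l * rankCount k l * rankCount k (i + j - l)) h1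
  rw [Finset.sum_pair h, Nat.add_sub_cancel, Nat.add_sub_cancel_left,
    ← Nat.choose_symm_add] at h2
  nlinarith

theorem rankCount_edge (k : ℕ) : rankCount k (k + 1) = 2 ^ k := by
  induction k with
  | zero => simp [rankCount]
  | succ k ih =>
    rw [rankCount_succ_succ, ih, Finset.sum_eq_zero, pow_succ]
    · ring
    · intro i _
      by_cases hi : i ≤ k
      · simp [rankCount_eq_zero_of_le hi]
      · simp [rankCount_eq_zero_of_le (k := k) (n := k + 1 - i) (by omega)]

theorem eight_mul_four_pow_le_choose {k : ℕ} (hk : 6 ≤ k) :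
    8 * 4 ^ k ≤ (3 * k + 1).choose (k + 1) := by
  induction k, hk using Nat.le_induction with
  | base => decide +kernel
  | succ k hk ih =>
    have h := Nat.choose_le_succ_of_lt_half_left (r := k + 1) (n := 3 * k + 1) (by omega)
    rw [show 3 * (k + 1) + 1 = 3 * k + 1 + 1 + 1 + 1 by ring]
    simp only [Nat.choose_succ_succ' _ (k + 1), Nat.choose_succ_succ' _ k] at *
    rw [pow_succ]
    omega

theorem four_pow_eq (k : ℕ) : 4 ^ k = (2 ^ k) ^ 2 := by
  rw [← pow_mul, mul_comm, pow_mul]; rfl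

theorem sixteen_pow_eq (k : ℕ) : 16 ^ k = (2 ^ k) ^ 4 := by
  rw [← pow_mul, mul_comm, pow_mul]; rfl

theorem sixteen_pow_le_rankCount {k : ℕ} (hk : 11 ≤ k)
    (hbase : ∀ k, 11 ≤ k → k < 23 → 16 ^ k ≤ rankCount k (2 * k + 1)) :
    16 ^ k ≤ rankCount k (2 * k + 1) := by
  induction k using Nat.strong_induction_on with
  | _ m ih =>
    rcases lt_or_ge m 23 with hm | hm
    · exact hbase m hk hm
    rcases Nat.even_or_odd' m with ⟨k, rfl | rfl⟩
    · obtain ⟨k, rfl⟩ : ∃ j, k = j + 1 := ⟨k - 1, by omega⟩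
      have h1 := two_pow_mul_rankCount_le (k + 2) (3 * k + 5) k
      have h2 := two_mul_choose_mul_rankCount_le (k + 1) (i := k + 2) (j := 2 * k + 2) (by omega)
      have h3 := two_mul_rankCount_le k (2 * k + 1)
      have h4 := ih k (by omega) (by omega)
      have h5 := eight_mul_four_pow_le_choose (k := k + 1) (by omega)
      rw [rankCount_edge (k + 1), show k + 2 + (2 * k + 2) = 3 * (k + 1) + 1 by ring,
        show 3 * (k + 1) + 1 + 1 = 3 * k + 5 by ring] at h2
      rw [show k + 2 + k = 2 * (k + 1) by ring,
        show 3 * k + 5 + k = 2 * (2 * (k + 1)) + 1 by ring] at h1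
      calc 16 ^ (2 * (k + 1)) = 2 ^ k * (2 * (8 * 4 ^ (k + 1)) * 2 ^ (k + 1) * (2 * 16 ^ k)) := by
            rw [show 16 ^ (2 * (k + 1)) = (16 ^ k) ^ 2 * 256 by ring, pow_succ 4, pow_succ 2,
              four_pow_eq, sixteen_pow_eq]
            ring
        _ ≤ 2 ^ k * (2 * (3 * (k + 1) + 1).choose (k + 1 + 1) * 2 ^ (k + 1) *
            rankCount (k + 1) (2 * k + 2)) := by
            gcongr
            exact le_trans (by omega) h3
        _ ≤ _ := le_trans (Nat.mul_le_mul_left _ h2) h1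
    · have h1 := two_pow_mul_rankCount_le (k + 1) (3 * k + 3) k
      have h2 := two_mul_choose_mul_rankCount_le k (i := k + 1) (j := 2 * k + 1) (by omega)
      have h4 := ih k (by omega) (by omega)
      have h5 := eight_mul_four_pow_le_choose (k := k) (by omega)
      have h6 := Nat.choose_le_choose (k + 1) (show 3 * k + 1 ≤ 3 * k + 2 by omega)
      rw [rankCount_edge k, show k + 1 + (2 * k + 1) = 3 * k + 2 by ring] at h2
      rw [show k + 1 + k = 2 * k + 1 by ring,
        show 3 * k + 3 + k = 2 * (2 * k + 1) + 1 by ring] at h1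
      calc 16 ^ (2 * k + 1) = 2 ^ k * (2 * (8 * 4 ^ k) * 2 ^ k * 16 ^ k) := by
            rw [show 16 ^ (2 * k + 1) = (16 ^ k) ^ 2 * 16 by ring, four_pow_eq, sixteen_pow_eq]
            ring
        _ ≤ 2 ^ k * (2 * (3 * k + 2).choose (k + 1) * 2 ^ k * rankCount k (2 * k + 1)) := by
            gcongr
            exact h5.trans h6
        _ ≤ _ := le_trans (Nat.mul_le_mul_left _ h2) h1

theorem rankProb_edge_sq_le {k : ℕ} (h : 16 ^ k ≤ rankCount k (2 * k + 1)) :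
    (k + 1) * rankProb k (k + 1) ^ 2 ≤ rankProb k (2 * k + 1) := by
  have h1 : (2 * k + 1).factorial * (k + 1) ≤ 4 ^ k * (k + 1).factorial ^ 2 := by
    have h2 := Nat.choose_middle_le_pow k
    have h3 := Nat.choose_mul_factorial_mul_factorial (show k ≤ 2 * k + 1 by omega)
    rw [show 2 * k + 1 - k = k + 1 by omega] at h3
    calc (2 * k + 1).factorial * (k + 1)
        = (2 * k + 1).choose k * ((k + 1) * k.factorial) * (k + 1).factorial := by
          rw [← h3]; ring
      _ ≤ 4 ^ k * ((k + 1) * k.factorial) * (k + 1).factorial := by gcongr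
      _ = _ := by rw [← Nat.factorial_succ]; ring
  rw [rankProb, rankProb, rankCount_edge, div_pow, ← mul_div_assoc,
    div_le_div_iff₀ (by positivity) (by positivity)]
  norm_cast
  calc (k + 1) * (2 ^ k) ^ 2 * (2 * k + 1).factorial
      = 4 ^ k * ((2 * k + 1).factorial * (k + 1)) := by
        rw [four_pow_eq]; ring
    _ ≤ 4 ^ k * (4 ^ k * (k + 1).factorial ^ 2) := by gcongr
    _ = 16 ^ k * (k + 1).factorial ^ 2 := by
        rw [show 16 = 4 * 4 by rfl, mul_pow]; ring
    _ ≤ _ := by gcongr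

/-! ### Evaluation of the recursion

The definitions below use recursors directly so that the kernel evaluates them quickly. -/

/-- Evaluate a natural number before passing it on. -/
def withForced (n : ℕ) (f : ℕ → Bool) : Bool :=
  Nat.rec (f 0) (fun m _ => f m.succ) n

theorem withForced_eq (n : ℕ) (f : ℕ → Bool) : withForced n f = f n := by
  cases n <;> rfl

/-- The sum of the products of corresponding entries of two lists. -/
def dot (l : List ℕ) : List ℕ → ℕ :=
  List.rec (fun _ => 0)
    (fun a _ ih m => List.rec 0 (fun b m' _ => Nat.add (Nat.mul a b) (ih m')) m) l

theorem dot_eq (l m : List ℕ) : dot l m = (List.zipWith (· * ·) l m).sum := by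
  induction l generalizing m with
  | nil => rfl
  | cons a l ih =>
    cases m with
    | nil => rfl
    | cons b m => 
      rw [List.zipWith_cons_cons, List.sum_cons, ← ih]
      rfl

/-- The entry with index `n + 1` of the row following `A`; here `F` is the common denominator
of the rows and `rev` lists the entries of `A` up to index `n` in reverse order. -/
def nextEntry (F : ℕ) (A : List ℕ) (a : ℕ) (rev : List ℕ) (n : ℕ) : ℕ :=
  Nat.div (Nat.add (Nat.mul (Nat.mul 2 F) a) (dot rev A)) (Nat.mul F n.succ)

/-- Compute the row following `A` and pass it on, reversed. -/
def withNextRow (F : ℕ) (A : List ℕ) (f : List ℕ → Bool) (l : List ℕ) :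
    List ℕ → ℕ → List ℕ → Bool :=
  List.rec (fun _ _ acc => f acc)
    (fun a _ ih rev n acc => withForced n fun n' =>
      withForced (nextEntry F A a (a :: rev) n') fun e => ih (a :: rev) n'.succ (e :: acc)) l

/-- The entries of the row following `A` that come from the tail `l` of `A`. -/
def nextEntries (F : ℕ) (A : List ℕ) : List ℕ → List ℕ → ℕ → List ℕ
  | [], _, _ => []
  | a :: l, rev, n => nextEntry F A a (a :: rev) n :: nextEntries F A l (a :: rev) (n + 1)

theorem withNextRow_eq (F : ℕ) (A : List ℕ) (f : List ℕ → Bool) (l rev : List ℕ) (n : ℕ)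
    (acc : List ℕ) :
    withNextRow F A f l rev n acc = f ((nextEntries F A l rev n).reverse ++ acc) := by
  induction l generalizing rev n acc with
  | nil => rfl
  | cons a l ih =>
    have h : withNextRow F A f (a :: l) rev n acc = withForced n fun n' =>
      withForced (nextEntry F A a (a :: rev) n') fun e =>
        withNextRow F A f l (a :: rev) n'.succ (e :: acc) := rfl
    rw [h, withForced_eq, withForced_eq, ih, nextEntries]
    simp

theorem length_nextEntries (F : ℕ) (A l rev : List ℕ) (n : ℕ) :
    (nextEntries F A l rev n).length = l.length := by
  induction l generalizing rev n with
  | nil => rfl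
  | cons a l ih => simp [nextEntries, ih]

theorem getD_nextEntries (F : ℕ) (A l rev : List ℕ) (n j : ℕ) (hj : j < l.length) :
    (nextEntries F A l rev n).getD j 0 =
      nextEntry F A (l.getD j 0) ((l.take (j + 1)).reverse ++ rev) (n + j) := by
  induction l generalizing rev n j with
  | nil => simp at hj
  | cons a l ih =>
    cases j with
    | zero => simp [nextEntries]
    | succ j =>
      rw [nextEntries, List.getD_cons_succ, ih _ _ _ (by simpa using hj)]
      simp [add_assoc, add_comm 1 j]

/-- Apply a test to `m + 1` successive rows. -/
def checkRows (F : ℕ) (test : ℕ → List ℕ → Bool) : ℕ → ℕ → List ℕ → Bool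
  | 0, k, A => test k A
  | m + 1, k, A => test k A &&
      withNextRow F A (fun l => checkRows F test m (k + 1) l.reverse) A [] 0 [0]

/-- `A` lists the integers `N! * rankProb k n` for `n ≤ N`, possibly followed by other numbers. -/
def IsRow (N k : ℕ) (A : List ℕ) : Prop :=
  N < A.length ∧ ∀ n ≤ N, ((A.getD n 0 : ℕ) : ℚ) = N.factorial * rankProb k n

theorem IsRow.next {N k : ℕ} {A : List ℕ} (h : IsRow N k A) :
    IsRow N (k + 1) (0 :: nextEntries N.factorial A A [] 0) := by
  refine ⟨by simpa [length_nextEntries] using h.1.trans (Nat.lt_succ_self _), fun n hn => ?_⟩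
  cases n with
  | zero => simp [rankProb, rankCount_zero_right]
  | succ n =>
    have hlen := h.1
    have hconv : List.zipWith (· * ·) ((A.take (n + 1)).reverse ++ []) A =
        (List.range (n + 1)).map fun i => A.getD (n - i) 0 * A.getD i 0 := by
      refine List.ext_getElem ?_ fun i h1 h2 => ?_
      · simp; omega
      · simp only [List.length_map, List.length_range] at h2
        have h3 : min (n + 1) A.length = n + 1 := by omega
        simp [h3, List.getD, show i < A.length by omega, show n - i < A.length by omega]
    have hsum : ((List.range (n + 1)).map fun i => A.getD (n - i) 0 * A.getD i 0).sum =
        ∑ i ∈ Finset.range (n + 1), A.getD (n - i) 0 * A.getD i 0 := rfl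
    have hs : ∑ i ∈ Finset.range (n + 1), ((A.getD (n - i) 0 : ℕ) : ℚ) * ((A.getD i 0 : ℕ) : ℚ) =
        N.factorial ^ 2 * ∑ i ∈ Finset.range (n + 1), rankProb k i * rankProb k (n - i) := by
      rw [Finset.mul_sum]
      refine Finset.sum_congr rfl fun i hi => ?_
      rw [Finset.mem_range] at hi
      rw [h.2 _ (by omega), h.2 _ (by omega)]
      ring
    have hrec := rankProb_succ_succ k n
    obtain ⟨v, hv⟩ : ∃ v : ℕ, (v : ℚ) = N.factorial * rankProb (k + 1) (n + 1) :=
      ⟨rankCount (k + 1) (n + 1) * (N.factorial / (n + 1).factorial), by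
        rw [rankProb, Nat.cast_mul,
          Nat.cast_div (Nat.factorial_dvd_factorial hn) (by positivity)]
        ring⟩
    rw [List.getD_cons_succ, getD_nextEntries _ _ _ _ _ _ (by omega), nextEntry, dot_eq, hconv,
      hsum, ← hv, Nat.cast_inj]
    refine Nat.div_eq_of_eq_mul_right (Nat.mul_pos (Nat.factorial_pos N) (Nat.succ_pos _)) ?_
    have : ((2 * N.factorial * A.getD n 0 +
        ∑ i ∈ Finset.range (n + 1), A.getD (n - i) 0 * A.getD i 0 : ℕ) : ℚ) =
        ((N.factorial * (n + 1) * v : ℕ) : ℚ) := by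
      push_cast
      rw [hs, h.2 n (by omega), hv]
      linear_combination -(N.factorial : ℚ) ^ 2 * hrec
    rw [Nat.zero_add]
    exact_mod_cast this

theorem exists_isRow_of_checkRows {N k m j : ℕ} {A : List ℕ} {test : ℕ → List ℕ → Bool}
    (hA : IsRow N k A) (h : checkRows N.factorial test m k A = true) (hj : j ≤ m) :
    ∃ B, IsRow N (k + j) B ∧ test (k + j) B = true := by
  induction m generalizing k j A with
  | zero =>
    obtain rfl : j = 0 := by omega
    exact ⟨A, hA, h⟩
  | succ m ih =>
    rw [checkRows, withNextRow_eq, Bool.and_eq_true] at h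
    cases j with
    | zero => exact ⟨A, hA, h.1⟩
    | succ j =>
      have := ih (k := k + 1) (j := j) hA.next (by simpa using h.2) (by omega)
      rwa [show k + 1 + j = k + (j + 1) by ring] at this

/-- The row for rank zero. -/
def initRow (N F : ℕ) : List ℕ := 0 :: F :: List.replicate (N - 1) 0

theorem isRow_initRow {N : ℕ} (hN : 1 ≤ N) : IsRow N 0 (initRow N N.factorial) := by
  refine ⟨by simp [initRow]; omega, fun n hn => ?_⟩
  match n with
  | 0 => simp [initRow, rankProb, rankCount]
  | 1 => simp [initRow, rankProb, rankCount]
  | n + 2 => 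
    have : n < N - 1 := by omega
    simp [initRow, rankProb, rankCount, List.getD, this]

/-! ### Ranks at least six -/

/-- The test that a list decreases, starting from the value `a`. -/
def decreasing (l : List ℕ) : ℕ → Bool :=
  List.rec (fun _ => true) (fun b _ ih a => Nat.ble b a && ih b) l

theorem getD_le_of_decreasing {l : List ℕ} {a j : ℕ} (h : decreasing l a = true)
    (hj : j < l.length) : l.getD j 0 ≤ (a :: l).getD j 0 := by
  induction l generalizing a j with
  | nil => simp at hj
  | cons b l ih =>
    have h' : (Nat.ble b a && decreasing l b) = true := h
    rw [Bool.and_eq_true, Nat.ble_eq] at h'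
    cases j with
    | zero => exact h'.1
    | succ j => exact ih h'.2 (by simpa using hj)

/-- The test that a row decreases from the index `s` to the index `t`. -/
def antitoneTest (s t : ℕ) (A : List ℕ) : Bool :=
  decreasing ((A.take (t + 1)).drop (s + 1)) (A.getD s 0)

theorem IsRow.rankProb_le {N k s t n : ℕ} {A : List ℕ} (hA : IsRow N k A)
    (h : antitoneTest s t A = true) (ht : t ≤ N) (hs : s ≤ n) (hn : n < t) :
    rankProb k (n + 1) ≤ rankProb k n := by
  have hlen := hA.1
  have h1 := getD_le_of_decreasing h (j := n - s) (by simp; omega)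
  have h2 : A.getD (n + 1) 0 ≤ A.getD n 0 := by
    convert h1 using 1
    · rw [List.getD, List.getD, List.getElem?_drop, List.getElem?_take_of_lt (by omega),
        show s + 1 + (n - s) = n + 1 by omega]
    · rcases eq_or_lt_of_le hs with rfl | hlt
      · simp
      · obtain ⟨m, hm⟩ : ∃ m, n - s = m + 1 := ⟨n - s - 1, by omega⟩
        rw [hm, List.getD_cons_succ, List.getD, List.getD, List.getElem?_drop,
          List.getElem?_take_of_lt (by omega), show s + 1 + m = n by omega]
  have h3 : ((A.getD (n + 1) 0 : ℕ) : ℚ) ≤ (A.getD n 0 : ℕ) := by exact_mod_cast h2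
  rw [hA.2 _ (by omega), hA.2 _ (by omega)] at h3
  exact le_of_mul_le_mul_left h3 (by positivity)

/-- The tests for the values needed near `n = 2 * k + 1`, where `F` is the common denominator
of the rows. -/
def midTest (F k : ℕ) (A : List ℕ) : Bool :=
  (Nat.ble k 6 || Nat.ble 10 k || Nat.ble (A.getD (2 * k + 1) 0) (A.getD (2 * k) 0)) &&
  (Nat.ble k 8 || Nat.ble 11 k ||
    Nat.ble ((k + 1) * (A.getD (k + 1) 0 * A.getD (k + 1) 0)) (F * A.getD (2 * k + 1) 0)) &&
  (Nat.ble k 10 || Nat.ble (16 ^ k * F) (A.getD (2 * k + 1) 0 * (2 * k + 1).factorial))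

theorem checkRows_antitoneTest : (withForced (Nat.factorial 127) fun F =>
    checkRows F (fun k => antitoneTest (if k = 6 then 7 else 9) 127) 6 0 (initRow 127 F)) =
      true := by
  decide +kernel

theorem checkRows_midTest : (withForced (Nat.factorial 45) fun F =>
    checkRows F (midTest F) 22 0 (initRow 45 F)) = true := by
  decide +kernel

theorem rankProb_succ_le_of_le_six {k n : ℕ} (hk : k ≤ 6) (hn : 9 ≤ n ∨ k = 6 ∧ 7 ≤ n) :
    rankProb k (n + 1) ≤ rankProb k n := by
  rcases lt_or_ge n 127 with h | h
  · have hc := checkRows_antitoneTest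
    rw [withForced_eq] at hc
    obtain ⟨A, hA, ht⟩ := exists_isRow_of_checkRows (isRow_initRow (by omega)) hc hk
    rw [zero_add] at hA ht
    exact hA.rankProb_le ht le_rfl (by split_ifs <;> omega) h
  · have h1 : 2 ^ (k + 1) ≤ 2 ^ 7 := Nat.pow_le_pow_right (by omega) (by omega)
    rw [rankProb, rankCount_eq_zero_of_two_pow_le (h1.trans (by omega))]
    simpa using rankProb_nonneg k n

theorem exists_isRow_midTest {k : ℕ} (hk : k ≤ 22) :
    ∃ A, IsRow 45 k A ∧ midTest (Nat.factorial 45) k A = true := by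
  have hc := checkRows_midTest
  rw [withForced_eq] at hc
  obtain ⟨A, hA, ht⟩ := exists_isRow_of_checkRows (isRow_initRow (by omega)) hc hk
  rw [zero_add] at hA ht
  exact ⟨A, hA, ht⟩

theorem rankProb_mid_of_lt_ten {k : ℕ} (h7 : 7 ≤ k) (h10 : k < 10) :
    rankProb k (2 * k + 1) ≤ rankProb k (2 * k) := by
  obtain ⟨A, hA, ht⟩ := exists_isRow_midTest (k := k) (by omega)
  simp only [midTest, Bool.and_eq_true, Bool.or_eq_true, Nat.ble_eq] at ht
  have h : A.getD (2 * k + 1) 0 ≤ A.getD (2 * k) 0 := by omega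
  rw [← Nat.cast_le (α := ℚ), hA.2 _ (by omega), hA.2 _ (by omega)] at h
  exact le_of_mul_le_mul_left h (by positivity)

theorem rankProb_edge_sq_le_of_nine_le {k : ℕ} (hk : 9 ≤ k) :
    (k + 1) * rankProb k (k + 1) ^ 2 ≤ rankProb k (2 * k + 1) := by
  rcases lt_or_ge k 11 with h11 | h11
  · obtain ⟨A, hA, ht⟩ := exists_isRow_midTest (k := k) (by omega)
    simp only [midTest, Bool.and_eq_true, Bool.or_eq_true, Nat.ble_eq] at ht
    have h : (k + 1) * (A.getD (k + 1) 0 * A.getD (k + 1) 0) ≤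
        Nat.factorial 45 * A.getD (2 * k + 1) 0 :=
      ht.1.2.resolve_left (by omega)
    rw [← Nat.cast_le (α := ℚ)] at h
    simp only [Nat.cast_mul] at h
    rw [hA.2 _ (by omega), hA.2 _ (by omega)] at h
    have hF : (0 : ℚ) < (Nat.factorial 45 : ℚ) ^ 2 := by positivity
    refine le_of_mul_le_mul_left ?_ hF
    push_cast at h
    linarith
  · refine rankProb_edge_sq_le (sixteen_pow_le_rankCount h11 fun j hj hj' => ?_)
    obtain ⟨A, hA, ht⟩ := exists_isRow_midTest (k := j) (by omega)
    simp only [midTest, Bool.and_eq_true, Bool.or_eq_true, Nat.ble_eq] at ht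
    have h := ht.2.resolve_left (by omega)
    rw [← Nat.cast_le (α := ℚ)] at h
    simp only [Nat.cast_mul] at h
    rw [hA.2 _ (by omega), rankProb, mul_assoc, div_mul_cancel₀ _ (by positivity), mul_comm] at h
    have hF : (0 : ℚ) < (Nat.factorial 45 : ℚ) := by positivity
    exact_mod_cast le_of_mul_le_mul_left h hF

theorem rankAntitone_of_six_le {k : ℕ} (hk : 6 ≤ k) : RankAntitone k := by
  induction k, hk using Nat.le_induction with
  | base => exact fun n hn => rankProb_succ_le_of_le_six le_rfl (Or.inr ⟨rfl, hn⟩)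
  | succ k hk ih =>
    refine ih.succ (by omega) ?_
    rcases lt_or_ge k 9 with h | h
    · exact rankProb_mid_of_lt_ten (k := k + 1) (by omega) (by omega)
    · exact rankProb_mid ih (rankProb_edge_sq_le_of_nine_le h)

/-! ### The sum over all ranks -/

theorem sum_rankCount_succ_le {n : ℕ} (h1 : 1 ≤ n) (h9 : n < 9) :
    ∑ k ∈ Finset.range (n + 1), rankCount k (n + 1) ≤
      (n + 1) * ∑ k ∈ Finset.range n, rankCount k n := by
  interval_cases n <;> decide +kernel

theorem sum_rankProb_succ_le {n : ℕ} (hn : 1 ≤ n) :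
    ∑ k ∈ Finset.range (n + 1), rankProb k (n + 1) ≤ ∑ k ∈ Finset.range n, rankProb k n := by
  rcases lt_or_ge n 9 with h9 | h9
  · simp only [rankProb]
    rw [← Finset.sum_div, ← Finset.sum_div, div_le_div_iff₀ (by positivity) (by positivity),
      Nat.factorial_succ]
    norm_cast
    have := Nat.mul_le_mul_right n.factorial (sum_rankCount_succ_le hn h9)
    linarith
  · obtain ⟨n, rfl⟩ : ∃ m, n = m + 1 := ⟨n - 1, by omega⟩
    rw [Finset.sum_range_succ, Finset.sum_range_succ, Finset.sum_range_succ]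
    have h1 : ∑ k ∈ Finset.range n, rankProb k (n + 1 + 1) ≤
        ∑ k ∈ Finset.range n, rankProb k (n + 1) := by
      refine Finset.sum_le_sum fun k hk => ?_
      rw [Finset.mem_range] at hk
      rcases le_total k 6 with h6 | h6
      · exact rankProb_succ_le_of_le_six h6 (Or.inl h9)
      · exact rankAntitone_of_six_le h6 _ (by omega)
    have h2 := rankProb_succ_edge n
    have h3 := rankProb_second_edge (k := n) (by omega)
    have h4 := rankProb_nonneg n (n + 1)
    have h5 : (n + 2) * (rankProb n (n + 2) + rankProb (n + 1) (n + 2)) ≤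
        (n + 2) * rankProb n (n + 1) := by
      have : (8 : ℚ) ≤ n := by exact_mod_cast (by omega : 8 ≤ n)
      nlinarith
    have h6 := le_of_mul_le_mul_left h5 (by positivity)
    rw [show n + 1 + 1 = n + 2 from rfl] at h1 ⊢
    linarith

open BT

/-! ### Trees of sequences -/

theorem length_takeWhile_add_le {l : List ℕ} {m : ℕ} (h : m ∈ l) :
    (l.takeWhile (· != m)).length < l.length ∧
      ((l.dropWhile (· != m)).tail).length < l.length := by
  have h1 := congrArg List.length (List.takeWhile_append_dropWhile (p := (· != m)) (l := l))
  rw [List.length_append] at h1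
  have h2 : l.dropWhile (· != m) ≠ [] := by
    intro h3
    rw [List.dropWhile_eq_nil_iff] at h3
    simpa using h3 m h
  have h3 := List.length_pos_of_ne_nil h2
  rw [List.length_tail]
  omega

theorem foldr_max_mem {l : List ℕ} (h : l ≠ []) : l.foldr max 0 ∈ l := by
  induction l with
  | nil => exact absurd rfl h
  | cons x l ih =>
    by_cases hl : l = []
    · simp [hl]
    · rw [List.foldr_cons]
      rcases max_choice x (l.foldr max 0) with h1 | h1 <;> rw [h1]
      · exact List.mem_cons_self
      · exact List.mem_cons_of_mem _ (ih hl)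

theorem treeOfAux_succ {l : List ℕ} (h : l ≠ []) (f : ℕ) : treeOfAux (f + 1) l =
    BT.node (l.foldr max 0) (treeOfAux f (l.takeWhile (· != l.foldr max 0)))
      (treeOfAux f ((l.dropWhile (· != l.foldr max 0)).tail)) := by
  cases l with
  | nil => exact absurd rfl h
  | cons x l => rfl

theorem treeOfAux_eq_treeOf {f : ℕ} {l : List ℕ} (h : l.length ≤ f) :
    treeOfAux f l = treeOf l := by
  suffices H : ∀ N f g : ℕ, ∀ l : List ℕ, l.length ≤ N → l.length ≤ f → l.length ≤ g →
      treeOfAux f l = treeOfAux g l from H _ _ _ _ le_rfl h le_rfl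
  intro N
  induction N with
  | zero =>
    intro f g l hN _ _
    obtain rfl := List.eq_nil_of_length_eq_zero (Nat.le_zero.mp hN)
    cases f <;> cases g <;> rfl
  | succ N ih =>
    intro f g l hN hf hg
    by_cases hl : l = []
    · subst hl
      cases f <;> cases g <;> rfl
    · have hpos := List.length_pos_of_ne_nil hl
      obtain ⟨h1, h2⟩ := length_takeWhile_add_le (foldr_max_mem hl)
      obtain ⟨f, rfl⟩ := Nat.exists_eq_succ_of_ne_zero (by omega : f ≠ 0)
      obtain ⟨g, rfl⟩ := Nat.exists_eq_succ_of_ne_zero (by omega : g ≠ 0)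
      rw [Nat.succ_eq_add_one, Nat.succ_eq_add_one, treeOfAux_succ hl, treeOfAux_succ hl,
        ih f g _ (by omega) (by omega) (by omega),
        ih f g (l.dropWhile _).tail (by omega) (by omega) (by omega)]

theorem treeOf_nil : treeOf [] = BT.nil := rfl

theorem takeWhile_append_cons {L R : List ℕ} {m : ℕ} (hL : m ∉ L) :
    (L ++ m :: R).takeWhile (· != m) = L := by
  rw [List.takeWhile_append_of_pos (by
    intro x hx
    simpa using fun h : x = m => hL (h ▸ hx))]
  simp

theorem tail_dropWhile_append_cons {L R : List ℕ} {m : ℕ} (hL : m ∉ L) :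
    ((L ++ m :: R).dropWhile (· != m)).tail = R := by
  rw [List.dropWhile_append_of_pos (by
    intro x hx
    simpa using fun h : x = m => hL (h ▸ hx))]
  simp

theorem takeWhile_append_cons_tail_dropWhile {l : List ℕ} {m : ℕ} (h : m ∈ l) :
    l.takeWhile (· != m) ++ m :: (l.dropWhile (· != m)).tail = l := by
  obtain ⟨L, R, rfl, hL⟩ := List.eq_append_cons_of_mem h
  rw [takeWhile_append_cons hL, tail_dropWhile_append_cons hL]

theorem foldr_max_le {l : List ℕ} {m : ℕ} (h : ∀ x ∈ l, x ≤ m) : l.foldr max 0 ≤ m := by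
  induction l with
  | nil => simp
  | cons x l ih => exact max_le (h x (by simp)) (ih fun y hy => h y (by simp [hy]))

theorem le_foldr_max {l : List ℕ} {x : ℕ} (h : x ∈ l) : x ≤ l.foldr max 0 := by
  induction l with
  | nil => simp at h
  | cons y l ih =>
    rcases List.mem_cons.mp h with rfl | h
    · exact le_max_left _ _
    · exact (ih h).trans (le_max_right _ _)

theorem treeOf_append_cons {L R : List ℕ} {m : ℕ} (hL : ∀ x ∈ L, x < m) (hR : ∀ x ∈ R, x < m) :
    treeOf (L ++ m :: R) = BT.node m (treeOf L) (treeOf R) := by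
  have hm : (L ++ m :: R).foldr max 0 = m := by
    refine le_antisymm (foldr_max_le fun x hx => ?_) (le_foldr_max (by simp))
    rw [List.mem_append, List.mem_cons] at hx
    rcases hx with hx | rfl | hx
    · exact (hL x hx).le
    · exact le_rfl
    · exact (hR x hx).le
  have hmL : m ∉ L := fun h => (hL m h).false
  rw [treeOf, show (L ++ m :: R).length = (L.length + R.length) + 1 by simp; omega,
    treeOfAux_succ (by simp), hm, takeWhile_append_cons hmL, tail_dropWhile_append_cons hmL,
    treeOfAux_eq_treeOf (by omega), treeOfAux_eq_treeOf (by omega)]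

theorem treeOf_eq_nil_iff {l : List ℕ} : treeOf l = BT.nil ↔ l = [] := by
  refine ⟨fun h => ?_, fun h => h ▸ rfl⟩
  by_contra hl
  rw [treeOf, ← Nat.succ_pred_eq_of_pos (List.length_pos_of_ne_nil hl), Nat.succ_eq_add_one,
    treeOfAux_succ hl] at h
  cases h

theorem balRank_node_eq_zero {v : ℕ} {l r : BT} :
    balRank (BT.node v l r) = some 0 ↔ l = BT.nil ∧ r = BT.nil := by
  cases l <;> cases r <;> simp [balRank]
  split <;> simp

theorem balRank_node_eq_succ {v k : ℕ} {l r : BT} :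
    balRank (BT.node v l r) = some (k + 1) ↔ (l = BT.nil ∨ balRank l = some k) ∧
      (r = BT.nil ∨ balRank r = some k) ∧ ¬(l = BT.nil ∧ r = BT.nil) := by
  cases l <;> cases r <;> simp [balRank]
  split
  · rename_i i j hi hj
    simp only [hi, hj, Option.some.injEq]
    split <;> simp <;> omega
  · rename_i h
    simp only [reduceCtorEq, false_iff]
    exact fun h' => h _ _ h'.1 h'.2

/-! ### Counting sequences -/

/-- The orderings of the elements of a finite set. -/
noncomputable def orderings (s : Finset ℕ) : Finset (List ℕ) := s.toList.permutations.toFinset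

theorem mem_orderings {s : Finset ℕ} {l : List ℕ} :
    l ∈ orderings s ↔ l.Nodup ∧ l.toFinset = s := by
  rw [orderings, List.mem_toFinset, List.mem_permutations]
  constructor
  · intro h
    exact ⟨h.nodup_iff.mpr s.nodup_toList, by rw [List.toFinset_eq_of_perm _ _ h]; simp⟩
  · rintro ⟨h1, rfl⟩
    exact (List.perm_of_nodup_nodup_toFinset_eq h1 (Finset.nodup_toList _) (by simp))

/-- The orderings of `s` whose decreasing tree has a balanced root of rank `k`. -/
noncomputable def balancedOrderings (k : ℕ) (s : Finset ℕ) : Finset (List ℕ) :=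
  {l ∈ orderings s | balRank (treeOf l) = some k}

/-- The orderings of `s` whose decreasing tree is empty or has a balanced root of rank `k`. -/
noncomputable def balancedOrEmptyOrderings (k : ℕ) (s : Finset ℕ) : Finset (List ℕ) :=
  {l ∈ orderings s | l = [] ∨ balRank (treeOf l) = some k}

theorem card_balancedOrEmptyOrderings (k : ℕ) (s : Finset ℕ) :
    (balancedOrEmptyOrderings k s).card =
      (balancedOrderings k s).card + if s.card = 0 then 1 else 0 := by
  rw [balancedOrEmptyOrderings, Finset.filter_or, Finset.card_union_of_disjoint, add_comm,
    balancedOrderings]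
  · congr 1
    split_ifs with h
    · rw [Finset.card_eq_zero] at h
      subst h
      rw [Finset.card_eq_one]
      refine ⟨[], ?_⟩
      ext l
      simp only [Finset.mem_filter, mem_orderings, Finset.mem_singleton]
      exact ⟨fun h => h.2, fun h => by simp [h]⟩
    · rw [Finset.card_eq_zero, Finset.filter_eq_empty_iff]
      rintro l hl rfl
      rw [mem_orderings] at hl
      exact h (by simp [← hl.2])
  · rw [Finset.disjoint_filter]
    rintro l - rfl
    simp [treeOf_nil, balRank]

theorem mem_orderings_append_cons {s : Finset ℕ} {L R : List ℕ} {m : ℕ} :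
    L ++ m :: R ∈ orderings s ↔ m ∈ s ∧ L.toFinset ⊆ s.erase m ∧
      L ∈ orderings L.toFinset ∧ R ∈ orderings (s.erase m \ L.toFinset) := by
  simp only [mem_orderings, Finset.ext_iff, Finset.subset_iff, List.nodup_append, List.nodup_cons,
    List.mem_toFinset, List.mem_append, List.mem_cons, Finset.mem_erase, Finset.mem_sdiff]
  grind

theorem card_fiber_balancedOrderings {k m : ℕ} {s A : Finset ℕ} (hm : m ∈ s)
    (hmax : ∀ x ∈ s, x ≤ m) (hs : s.erase m ≠ ∅) (hA : A ⊆ s.erase m) :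
    {l ∈ balancedOrderings (k + 1) s | (l.takeWhile (· != m)).toFinset = A}.card =
      (balancedOrEmptyOrderings k A).card * (balancedOrEmptyOrderings k (s.erase m \ A)).card := by
  have key : ∀ L R : List ℕ, L.toFinset = A → (L ++ m :: R ∈ balancedOrderings (k + 1) s ↔
      L ∈ balancedOrEmptyOrderings k A ∧ R ∈ balancedOrEmptyOrderings k (s.erase m \ A)) := by
    rintro L R rfl
    have h2 : ∀ B ⊆ s.erase m, ∀ x ∈ B, x < m := fun B hB x hx =>
      lt_of_le_of_ne (hmax x (Finset.mem_of_mem_erase (hB hx))) (Finset.ne_of_mem_erase (hB hx))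
    simp only [balancedOrderings, balancedOrEmptyOrderings, Finset.mem_filter,
      mem_orderings_append_cons, hm, hA, true_and]
    constructor
    · rintro ⟨⟨h3, h4⟩, h5⟩
      have hR : ∀ x ∈ R, x < m := fun x hx =>
        h2 _ Finset.sdiff_subset x ((mem_orderings.mp h4).2 ▸ List.mem_toFinset.mpr hx)
      rw [treeOf_append_cons (fun x hx => h2 _ hA x (List.mem_toFinset.mpr hx)) hR,
        balRank_node_eq_succ, treeOf_eq_nil_iff, treeOf_eq_nil_iff] at h5
      exact ⟨⟨h3, h5.1⟩, h4, h5.2.1⟩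
    · rintro ⟨⟨h3, h5⟩, h4, h6⟩
      have hR : ∀ x ∈ R, x < m := fun x hx =>
        h2 _ Finset.sdiff_subset x ((mem_orderings.mp h4).2 ▸ List.mem_toFinset.mpr hx)
      rw [treeOf_append_cons (fun x hx => h2 _ hA x (List.mem_toFinset.mpr hx)) hR,
        balRank_node_eq_succ, treeOf_eq_nil_iff, treeOf_eq_nil_iff]
      refine ⟨⟨h3, h4⟩, h5, h6, ?_⟩
      rintro ⟨rfl, rfl⟩
      have := (mem_orderings.mp h4).2
      simp only [List.toFinset_nil, Finset.sdiff_empty] at this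
      exact hs this.symm
  have hmA : ∀ L : List ℕ, L.toFinset = A → m ∉ L := by
    rintro L rfl h
    simpa using hA (List.mem_toFinset.mpr h)
  rw [← Finset.card_product]
  refine Finset.card_nbij' (fun l => (l.takeWhile (· != m), (l.dropWhile (· != m)).tail))
    (fun q => q.1 ++ m :: q.2) ?_ ?_ ?_ ?_
  · intro l hl
    rw [Finset.mem_coe, Finset.mem_filter] at hl
    have hml : m ∈ l := by
      have := (mem_orderings.mp (Finset.mem_filter.mp hl.1).1).2
      rw [← List.mem_toFinset, this]
      exact hm
    rw [Finset.mem_coe, Finset.mem_product]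
    rw [← key _ _ hl.2, takeWhile_append_cons_tail_dropWhile hml]
    exact hl.1
  · intro q hq
    rw [Finset.mem_coe, Finset.mem_product] at hq
    have h1 := (mem_orderings.mp (Finset.mem_filter.mp hq.1).1).2
    rw [Finset.mem_coe, Finset.mem_filter, key _ _ h1, takeWhile_append_cons (hmA _ h1)]
    exact ⟨hq, h1⟩
  · intro l hl
    rw [Finset.mem_coe, Finset.mem_filter] at hl
    have hml : m ∈ l := by
      have := (mem_orderings.mp (Finset.mem_filter.mp hl.1).1).2
      rw [← List.mem_toFinset, this]
      exact hm
    exact takeWhile_append_cons_tail_dropWhile hml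
  · intro q hq
    rw [Finset.mem_coe, Finset.mem_product] at hq
    have h1 := hmA _ (mem_orderings.mp (Finset.mem_filter.mp hq.1).1).2
    simp only [takeWhile_append_cons h1, tail_dropWhile_append_cons h1]

theorem mem_orderings_of_card_eq_one {s : Finset ℕ} {l : List ℕ} (hs : s.card = 1)
    (hl : l ∈ orderings s) : ∃ m, l = [m] := by
  rw [mem_orderings] at hl
  rw [← List.length_eq_one_iff, ← List.toFinset_card_of_nodup hl.1, hl.2, hs]

theorem balRank_treeOf_singleton (m : ℕ) : balRank (treeOf [m]) = some 0 := by
  have := treeOf_append_cons (L := []) (R := []) (m := m) (by simp) (by simp)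
  rw [List.nil_append] at this
  rw [this, balRank_node_eq_zero]
  exact ⟨rfl, rfl⟩

theorem exists_append_cons_mem_orderings {s : Finset ℕ} {l : List ℕ} (hl : l ∈ orderings s)
    (hs : s.Nonempty) : ∃ L R m, l = L ++ m :: R ∧ (∀ x ∈ L, x < m) ∧ ∀ x ∈ R, x < m := by
  rw [mem_orderings] at hl
  have hm := s.max'_mem hs
  have hml : s.max' hs ∈ l := by rwa [← List.mem_toFinset, hl.2]
  obtain ⟨L, R, h⟩ := List.append_of_mem hml
  refine ⟨L, R, _, h, ?_, ?_⟩ <;> intro x hx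
  all_goals
    have hle : x ≤ s.max' hs := by
      refine s.le_max' x ?_
      rw [← hl.2, List.mem_toFinset, h]
      simp [hx]
    refine lt_of_le_of_ne hle ?_
    have := hl.1
    rw [h] at this
    grind

theorem card_balancedOrderings (k : ℕ) (s : Finset ℕ) :
    (balancedOrderings k s).card = rankCount k s.card := by
  rcases s.eq_empty_or_nonempty with rfl | hne
  · rw [Finset.card_empty, rankCount_zero_right, Finset.card_eq_zero, balancedOrderings,
      Finset.filter_eq_empty_iff]
    intro l hl
    rw [mem_orderings, List.toFinset_eq_empty_iff] at hl
    simp [hl.2, treeOf_nil, balRank]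
  induction k generalizing s with
  | zero =>
    rw [rankCount]
    split_ifs with h1
    · obtain ⟨m, rfl⟩ := Finset.card_eq_one.mp h1
      rw [Finset.card_eq_one]
      refine ⟨[m], ?_⟩
      ext l
      rw [balancedOrderings, Finset.mem_filter, Finset.mem_singleton]
      constructor
      · rintro ⟨hl, -⟩
        obtain ⟨x, rfl⟩ := mem_orderings_of_card_eq_one h1 hl
        have := (mem_orderings.mp hl).2
        simp at this
        rw [this]
      · rintro rfl
        exact ⟨by simp [mem_orderings], balRank_treeOf_singleton m⟩
    · rw [Finset.card_eq_zero, balancedOrderings, Finset.filter_eq_empty_iff]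
      intro l hl hb
      obtain ⟨L, R, m, rfl, hL, hR⟩ := exists_append_cons_mem_orderings hl hne
      rw [treeOf_append_cons hL hR, balRank_node_eq_zero, treeOf_eq_nil_iff,
        treeOf_eq_nil_iff] at hb
      rw [mem_orderings, hb.1, hb.2] at hl
      exact h1 (by rw [← hl.2]; simp)
  | succ k ih =>
    have ih' : ∀ A : Finset ℕ, (balancedOrEmptyOrderings k A).card =
        rankCount k A.card + if A.card = 0 then 1 else 0 := by
      intro A
      rw [card_balancedOrEmptyOrderings]
      rcases A.eq_empty_or_nonempty with rfl | hA
      · rw [Finset.card_empty, rankCount_zero_right]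
        congr 1
        rw [Finset.card_eq_zero, balancedOrderings, Finset.filter_eq_empty_iff]
        intro l hl
        rw [mem_orderings, List.toFinset_eq_empty_iff] at hl
        simp [hl.2, treeOf_nil, balRank]
      · rw [ih A hA]
    set m := s.max' hne with hm
    have hms : m ∈ s := s.max'_mem hne
    have hcard : s.card = (s.erase m).card + 1 := (Finset.card_erase_add_one hms).symm
    by_cases hs : s.erase m = ∅
    · rw [hs, Finset.card_empty] at hcard
      rw [rankCount_eq_zero_of_le (by omega), Finset.card_eq_zero, balancedOrderings,
        Finset.filter_eq_empty_iff]
      intro l hl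
      obtain ⟨x, rfl⟩ := mem_orderings_of_card_eq_one hcard hl
      simp [balRank_treeOf_singleton]
    · have hmap : ∀ l ∈ balancedOrderings (k + 1) s,
          (l.takeWhile (· != m)).toFinset ∈ (s.erase m).powerset := by
        intro l hl
        have h1 := (mem_orderings.mp (Finset.mem_filter.mp hl).1).2
        rw [Finset.mem_powerset]
        intro x hx
        rw [List.mem_toFinset] at hx
        have h2 : x ∈ s := by
          rw [← h1, List.mem_toFinset]
          exact (List.takeWhile_sublist _).mem hx
        have h3 := List.mem_takeWhile_imp hx
        simpa [h2] using h3
      have hn : (s.erase m).card ≠ 0 := by rwa [Ne, Finset.card_eq_zero]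
      rw [Finset.card_eq_sum_card_fiberwise hmap, hcard, rankCount_succ_succ]
      set n := (s.erase m).card with hn'
      have hsum : ∀ A ∈ (s.erase m).powerset,
          {l ∈ balancedOrderings (k + 1) s | (l.takeWhile (· != m)).toFinset = A}.card =
          (fun i => (rankCount k i + if i = 0 then 1 else 0) *
            (rankCount k (n - i) + if n - i = 0 then 1 else 0)) A.card := by
        intro A hA
        rw [Finset.mem_powerset] at hA
        rw [card_fiber_balancedOrderings hms (fun x hx => s.le_max' x hx) hs hA, ih', ih',
          Finset.card_sdiff_of_subset hA]
      rw [Finset.sum_congr rfl hsum, Finset.sum_powerset_apply_card (x := s.erase m) fun i =>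
        (rankCount k i + if i = 0 then 1 else 0) *
          (rankCount k (n - i) + if n - i = 0 then 1 else 0), ← hn']
      have hsplit : ∀ i ∈ Finset.range (n + 1), n.choose i • ((rankCount k i +
          if i = 0 then 1 else 0) * (rankCount k (n - i) + if n - i = 0 then 1 else 0)) =
          (if i = 0 then rankCount k n else 0) + (if i = n then rankCount k n else 0) +
            n.choose i * rankCount k i * rankCount k (n - i) := by
        intro i hi
        rw [Finset.mem_range] at hi
        by_cases h0 : i = 0
        · subst h0
          simp [hn, hn.symm, rankCount_zero_right]
        · by_cases h1 : i = n
          · subst h1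
            simp [hn, rankCount_zero_right]
          · simp [h0, h1, show n - i ≠ 0 by omega, mul_assoc]
      rw [Finset.sum_congr rfl hsplit, Finset.sum_add_distrib, Finset.sum_add_distrib]
      simp [two_mul]

theorem rootBal_eq_sum_rankCount (n : ℕ) :
    rootBal n = ∑ k ∈ Finset.range n, rankCount k n := by
  have hnodup : (perms n).Nodup := List.nodup_permutations _ List.nodup_range'
  have hperms : (perms n).toFinset = orderings (Finset.Icc 1 n) := by
    ext l
    rw [List.mem_toFinset, perms, List.mem_permutations, mem_orderings]
    constructor
    · intro h
      refine ⟨h.nodup_iff.mpr List.nodup_range', ?_⟩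
      ext x
      rw [List.mem_toFinset, h.mem_iff, List.mem_range'_1, Finset.mem_Icc]
      omega
    · rintro ⟨h1, h2⟩
      refine List.perm_of_nodup_nodup_toFinset_eq h1 List.nodup_range' ?_
      rw [h2]
      ext x
      rw [List.mem_toFinset, List.mem_range'_1, Finset.mem_Icc]
      omega
  have hcard : (Finset.Icc 1 n).card = n := by simp
  have hunion : ((perms n).filter fun l => (balRank (treeOf l)).isSome).toFinset =
      (Finset.range n).biUnion fun k => balancedOrderings k (Finset.Icc 1 n) := by
    ext l
    rw [List.toFinset_filter, hperms, Finset.mem_filter, Finset.mem_biUnion,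
      Option.isSome_iff_exists]
    simp only [balancedOrderings, Finset.mem_filter]
    constructor
    · rintro ⟨hl, k, hk⟩
      refine ⟨k, ?_, hl, hk⟩
      rw [Finset.mem_range]
      by_contra! hkn
      have h1 := card_balancedOrderings k (Finset.Icc 1 n)
      rw [hcard, rankCount_eq_zero_of_le hkn, Finset.card_eq_zero] at h1
      exact Finset.notMem_empty l (h1 ▸ Finset.mem_filter.mpr ⟨hl, hk⟩)
    · rintro ⟨k, -, hl, hk⟩
      exact ⟨hl, k, hk⟩
  rw [rootBal, ← List.toFinset_card_of_nodup (hnodup.filter _), hunion, Finset.card_biUnion]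
  · refine Finset.sum_congr rfl fun k _ => ?_
    rw [card_balancedOrderings, hcard]
  · intro i _ j _ hij
    rw [Function.onFun, balancedOrderings, balancedOrderings, Finset.disjoint_filter]
    intro l _ hi hj
    rw [hi, Option.some.injEq] at hj
    exact hij hj

end BalancedTrees

open BalancedTrees

/-- For every `n ≥ 1`, `p(n+1) ≤ p(n)`, where `p(n)` is the probability that
the root of a uniformly random decreasing binary tree on `{1,…,n}` is
balanced. -/
theorem statement5 (n : ℕ) (hn : 1 ≤ n) : proot (n + 1) ≤ proot n := by
  have h := sum_rankProb_succ_le hn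
  simpa only [proot, rankProb, ← Finset.sum_div, ← Nat.cast_sum, ← rootBal_eq_sum_rankCount] using h
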